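/- arXiv:1707.09004 — 3 statements merged into one kernel-verified Lean document; each statement's English description precedes it below -/
import Mathlib

section
/- The functions χ_k satisfy the dual-hypergroup convolution identities: (1) for all m,n ∈ ℕ with m ≠ n and every t ∈ ℕ, χ_m(t)·χ_n(t) = χ_{min(m,n)}(t); (2) for every m ∈ ℕ and every t ∈ ℕ, χ_m(t)² = ∑_{j=0}^{∞} γ^m_j·χ_j(t), where the series converges. -/
/-- `β k = −(∑_{j ≤ k} v j) / v (k+1)`. -/
noncomputable def betav (v : ℕ → ℝ) (k : ℕ) : ℝ :=
  -(∑ j ∈ Finset.range (k + 1), v j) / v (k + 1)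

/-- The function `χ_k : ℕ → ℝ`: equal to `1` on `{0,…,k}`, `β k` at `k+1`, `0` above. -/
noncomputable def chiv (v : ℕ → ℝ) (k n : ℕ) : ℝ :=
  if n ≤ k then 1 else if n = k + 1 then betav v k else 0

/-- `γ^m_j`: zero for `j < m`, `1 + β m` at `j = m`, and
`∏_{i=m}^{j−1} (−β i)/(1 − β (i+1))` for `j > m`. -/
noncomputable def gamv (v : ℕ → ℝ) (m j : ℕ) : ℝ :=
  if j < m then 0
  else if j = m then 1 + betav v m
  else ∏ i ∈ Finset.Ico m j, (-(betav v i)) / (1 - betav v (i + 1))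

lemma chiv_of_le {v : ℕ → ℝ} {k n : ℕ} (h : n ≤ k) : chiv v k n = 1 := by
  simp [chiv, h]

lemma chiv_succ (v : ℕ → ℝ) (k : ℕ) : chiv v k (k + 1) = betav v k := by
  simp [chiv]

lemma chiv_of_lt {v : ℕ → ℝ} {k n : ℕ} (h : k + 1 < n) : chiv v k n = 0 := by
  simp [chiv, show ¬ n ≤ k by omega, show n ≠ k + 1 by omega]

lemma chiv_mul_of_lt {v : ℕ → ℝ} {m n : ℕ} (h : m < n) (t : ℕ) :
    chiv v m t * chiv v n t = chiv v m t := by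
  rcases le_or_gt t n with ht | ht
  · rw [chiv_of_le ht, mul_one]
  · rw [chiv_of_lt (show m + 1 < t by omega), zero_mul]

lemma sum_range_succ_pos {v : ℕ → ℝ} (hv : ∀ n, 0 < v n) (n : ℕ) :
    0 < ∑ j ∈ Finset.range (n + 1), v j :=
  Finset.sum_pos (fun j _ => hv j) (by simp)

/-- Closed form of `gamv` above the diagonal, in terms of the partial sums of `v`. -/
lemma gamv_add_succ {v : ℕ → ℝ} (hv : ∀ n, 0 < v n) (m p : ℕ) :
    gamv v m (m + p + 1) =
      (∑ j ∈ Finset.range (m + 1), v j) * (∑ j ∈ Finset.range (m + 2), v j) / v (m + 1) *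
        ((∑ j ∈ Finset.range (m + p + 2), v j)⁻¹ - (∑ j ∈ Finset.range (m + p + 3), v j)⁻¹) := by
  have ratio : ∀ i, -betav v i / (1 - betav v (i + 1)) =
      (∑ j ∈ Finset.range (i + 1), v j) * v (i + 2) /
        (v (i + 1) * ∑ j ∈ Finset.range (i + 3), v j) := by
    intro i
    have h1 := hv (i + 1)
    have h2 := hv (i + 2)
    have h3 := sum_range_succ_pos hv (i + 1)
    have h4 := sum_range_succ_pos hv (i + 2)
    have e : 1 - betav v (i + 1) = (∑ j ∈ Finset.range (i + 3), v j) / v (i + 2) := by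
      rw [betav, Finset.sum_range_succ v (i + 2)]
      field_simp
      ring
    rw [e, betav]
    field_simp
  have hprod : gamv v m (m + p + 1) =
      ∏ i ∈ Finset.Ico m (m + p + 1), -betav v i / (1 - betav v (i + 1)) := by
    simp [gamv, show ¬ m + p + 1 < m by omega, show m + p + 1 ≠ m by omega]
  rw [hprod]
  clear hprod
  induction p with
  | zero =>
    have h1 := hv (m + 1)
    have h2 := sum_range_succ_pos hv (m + 1)
    have h3 := sum_range_succ_pos hv (m + 2)
    have e := Finset.sum_range_succ v (m + 2)
    simp only [add_zero, Nat.Ico_succ_singleton, Finset.prod_singleton]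
    rw [ratio, inv_sub_inv h2.ne' h3.ne', e, add_sub_cancel_left, ← e]
    field_simp
  | succ p ih =>
    have h0 := hv (m + 1)
    have h1 := hv (m + p + 2)
    have h2 := sum_range_succ_pos hv (m + p + 1)
    have h3 := sum_range_succ_pos hv (m + p + 2)
    have h4 := sum_range_succ_pos hv (m + p + 3)
    have e := Finset.sum_range_succ v (m + p + 2)
    have e' := Finset.sum_range_succ v (m + p + 3)
    rw [← add_assoc m p 1, Finset.prod_Ico_succ_top (by omega), ih, ratio,
      show m + p + 1 + 2 = m + p + 3 by ring, show m + p + 1 + 3 = m + p + 4 by ring,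
      show m + p + 1 + 1 = m + p + 2 by ring, inv_sub_inv h2.ne' h3.ne',
      inv_sub_inv h3.ne' h4.ne', e', add_sub_cancel_left, ← e', e, add_sub_cancel_left, ← e]
    field_simp

lemma tendsto_sum_range_atTop {v : ℕ → ℝ} (hv1 : ∀ n, 1 ≤ v n) :
    Filter.Tendsto (fun n => ∑ j ∈ Finset.range n, v j) Filter.atTop Filter.atTop := by
  refine Filter.tendsto_atTop_mono (fun n => ?_) tendsto_natCast_atTop_atTop
  simpa using Finset.card_nsmul_le_sum (Finset.range n) v 1 fun i _ => hv1 i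

lemma hasSum_gamv_tail {v : ℕ → ℝ} (hv1 : ∀ n, 1 ≤ v n) (m p : ℕ) :
    HasSum (fun n => gamv v m (n + (m + p + 1)))
      ((∑ j ∈ Finset.range (m + 1), v j) * (∑ j ∈ Finset.range (m + 2), v j) / v (m + 1) *
        (∑ j ∈ Finset.range (m + p + 2), v j)⁻¹) := by
  have hv : ∀ n, 0 < v n := fun n => one_pos.trans_le (hv1 n)
  set C := (∑ j ∈ Finset.range (m + 1), v j) * (∑ j ∈ Finset.range (m + 2), v j) / v (m + 1)
    with hC
  have hC0 : 0 ≤ C := (div_pos (mul_pos (sum_range_succ_pos hv m)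
    (sum_range_succ_pos hv (m + 1))) (hv _)).le
  set g : ℕ → ℝ := fun n => (∑ j ∈ Finset.range (n + (m + p + 2)), v j)⁻¹ with hg
  have key : ∀ n, gamv v m (n + (m + p + 1)) = C * (g n - g (n + 1)) := by
    intro n
    rw [show n + (m + p + 1) = m + (p + n) + 1 by ring, gamv_add_succ hv, hC, hg]
    simp only
    rw [show m + (p + n) + 2 = n + (m + p + 2) by ring,
      show m + (p + n) + 3 = n + 1 + (m + p + 2) by ring]
  have hmono : ∀ n, g (n + 1) ≤ g n := by
    intro n
    refine inv_anti₀ (sum_range_succ_pos hv (n + (m + p + 1))) ?_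
    exact Finset.sum_le_sum_of_subset_of_nonneg
      (Finset.range_mono (by omega)) fun i _ _ => (hv i).le
  have hlim : Filter.Tendsto g Filter.atTop (nhds 0) :=
    ((Filter.tendsto_add_atTop_iff_nat (m + p + 2)).2
      (tendsto_sum_range_atTop hv1)).inv_tendsto_atTop
  simp only [key]
  rw [hasSum_iff_tendsto_nat_of_nonneg
    fun n => mul_nonneg hC0 (sub_nonneg.2 (hmono n))]
  simp only [← Finset.mul_sum, Finset.sum_range_sub']
  have h0 : g 0 = (∑ j ∈ Finset.range (m + p + 2), v j)⁻¹ := by simp [hg]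
  simpa [h0] using (hlim.const_sub (g 0)).const_mul C

/-- A sum over `ℕ` whose terms below `k` vanish splits off the term at `k`. -/
lemma hasSum_of_eq_zero_of_lt {f : ℕ → ℝ} {k : ℕ} {a : ℝ} (h0 : ∀ j < k, f j = 0)
    (h : HasSum (fun n => f (n + (k + 1))) a) : HasSum f (f k + a) := by
  rw [← hasSum_nat_add_iff' (k + 1), Finset.sum_range_succ,
    Finset.sum_eq_zero fun j hj => h0 j (Finset.mem_range.1 hj)]
  simpa using h

lemma hasSum_gamv_mul_chiv {v : ℕ → ℝ} (hv1 : ∀ n, 1 ≤ v n) (m t : ℕ) :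
    HasSum (fun j => gamv v m j * chiv v j t) (chiv v m t ^ 2) := by
  have hv : ∀ n, 0 < v n := fun n => one_pos.trans_le (hv1 n)
  have tail : ∀ p, t ≤ m + p + 1 →
      HasSum (fun n => gamv v m (n + (m + p + 1)) * chiv v (n + (m + p + 1)) t)
        ((∑ j ∈ Finset.range (m + 1), v j) * (∑ j ∈ Finset.range (m + 2), v j) / v (m + 1) *
          (∑ j ∈ Finset.range (m + p + 2), v j)⁻¹) := by
    intro p hp
    convert hasSum_gamv_tail hv1 m p using 2 with n
    rw [chiv_of_le (by omega), mul_one]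
  rcases le_or_gt t (m + 1) with ht | ht
  · have h := hasSum_of_eq_zero_of_lt (f := fun j => gamv v m j * chiv v j t) (k := m)
      (fun j hj => by simp [gamv, hj]) (tail 0 (by omega))
    convert h using 1
    have h1 := hv (m + 1)
    have h2 := sum_range_succ_pos hv (m + 1)
    have hγ : gamv v m m = 1 + betav v m := by simp [gamv]
    have hb : (∑ j ∈ Finset.range (m + 1), v j) * (∑ j ∈ Finset.range (m + 2), v j) / v (m + 1) *
        (∑ j ∈ Finset.range (m + 0 + 2), v j)⁻¹ = -betav v m := by
      rw [betav, add_zero]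
      field_simp
    simp only [hγ, hb]
    rcases ht.lt_or_eq with ht | rfl
    · rw [chiv_of_le (by omega)]
      ring
    · rw [chiv_succ]
      ring
  · obtain ⟨p, rfl⟩ : ∃ p, t = m + p + 2 := ⟨t - m - 2, by omega⟩
    have h := hasSum_of_eq_zero_of_lt
      (f := fun j => gamv v m j * chiv v j (m + p + 2)) (k := m + p + 1)
      (fun j hj => by simp [chiv_of_lt (show j + 1 < m + p + 2 by omega)])
      (tail (p + 1) (by omega))
    convert h using 1
    have h1 := hv (m + p + 2)
    have h0 := hv (m + 1)
    have h2 := sum_range_succ_pos hv (m + p + 1)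
    have h3 := sum_range_succ_pos hv (m + p + 2)
    have e := Finset.sum_range_succ v (m + p + 2)
    rw [chiv_of_lt ht, chiv_succ, gamv_add_succ hv, betav, inv_sub_inv h2.ne' h3.ne', e,
      add_sub_cancel_left, ← e, show m + (p + 1) + 2 = m + p + 3 by ring]
    field_simp
    simp

/-- Theorem 3.8 (convolution identities for the dual hypergroup): pointwise,
`χ_m · χ_n = χ_{min m n}` for `m ≠ n`, and `χ_m² = ∑_j γ^m_j · χ_j`
(a convergent series). -/
theorem dual_convolution_identities (v : ℕ → ℝ) (hv0 : v 0 = 1) (hv1 : ∀ n, 1 ≤ v n)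
    (hvsum : ∀ n : ℕ, 1 ≤ n → ∑ j ∈ Finset.range n, v j ≤ v n) :
    (∀ m n : ℕ, m ≠ n → ∀ t : ℕ, chiv v m t * chiv v n t = chiv v (min m n) t) ∧
    (∀ m t : ℕ, HasSum (fun j : ℕ => gamv v m j * chiv v j t) ((chiv v m t) ^ 2)) := by
  refine ⟨fun m n hmn t => ?_, hasSum_gamv_mul_chiv hv1⟩
  rcases hmn.lt_or_gt with h | h
  · rw [min_eq_left h.le, chiv_mul_of_lt h]
  · rw [min_eq_right h.le, mul_comm, chiv_mul_of_lt h]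
end

section
/- Let ξ : ℕ → ℂ satisfy: ξ(min(m,n)) = ξ(m)·ξ(n) for all m,n ∈ ℕ with m ≠ n; ξ(m)² = ∑_{j=0}^{∞} γ^m_j·ξ(j) for every m ∈ ℕ (with the series convergent); and ξ(k) → 1 as k → ∞. Then either ξ is identically 1, or there exists w ∈ ℕ such that ξ(k) = 0 for k < w, ξ(w) = β_w, and ξ(k) = 1 for k > w. -/
theorem betav_neg {v : ℕ → ℝ} (hv1 : ∀ n, 1 ≤ v n) (k : ℕ) : betav v k < 0 := by
  have hpos : ∀ n, 0 < v n := fun n => one_pos.trans_le (hv1 n)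
  unfold betav
  exact div_neg_of_neg_of_pos
    (neg_neg_of_pos (Finset.sum_pos (fun i _ => hpos i) (by simp))) (hpos _)

theorem neg_one_le_betav {v : ℕ → ℝ} (hv1 : ∀ n, 1 ≤ v n)
    (hvsum : ∀ n : ℕ, 1 ≤ n → ∑ j ∈ Finset.range n, v j ≤ v n) (k : ℕ) :
    -1 ≤ betav v k := by
  have h := hvsum (k + 1) (by omega)
  have hp : 0 < v (k + 1) := one_pos.trans_le (hv1 _)
  unfold betav
  rw [le_div_iff₀ hp]
  linarith

theorem gamv_of_lt (v : ℕ → ℝ) {m j : ℕ} (h : m < j) :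
    gamv v m j = ∏ i ∈ Finset.Ico m j, (-(betav v i)) / (1 - betav v (i + 1)) := by
  rw [gamv, if_neg (by omega), if_neg (by omega)]

theorem gamv_nonneg_of_lt {v : ℕ → ℝ} (hv1 : ∀ n, 1 ≤ v n) {m j : ℕ} (h : m < j) :
    0 ≤ gamv v m j := by
  rw [gamv_of_lt v h]
  refine Finset.prod_nonneg fun i _ => ?_
  have h1 := betav_neg hv1 i
  have h2 := betav_neg hv1 (i + 1)
  exact div_nonneg (by linarith) (by linarith)

theorem sum_range_gamv {v : ℕ → ℝ} (hv1 : ∀ n, 1 ≤ v n) (m p : ℕ) :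
    ∑ j ∈ Finset.range (p + 1), gamv v m (j + (m + 1)) =
      -betav v m + gamv v m (p + (m + 1)) * betav v (p + (m + 1)) := by
  induction p with
  | zero =>
    have h := betav_neg hv1 (m + 1)
    have h' : 1 - betav v (m + 1) ≠ 0 := by linarith
    simp only [zero_add, Finset.sum_range_one]
    rw [gamv_of_lt v (Nat.lt_succ_self m), Nat.Ico_succ_singleton, Finset.prod_singleton]
    field_simp
    ring
  | succ p ih =>
    have h := betav_neg hv1 (p + (m + 1) + 1)
    have h' : 1 - betav v (p + (m + 1) + 1) ≠ 0 := by linarith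
    rw [Finset.sum_range_succ, ih, show p + 1 + (m + 1) = p + (m + 1) + 1 by ring,
      gamv_of_lt v (show m < p + (m + 1) + 1 by omega),
      Finset.prod_Ico_succ_top (by omega), ← gamv_of_lt v (by omega)]
    field_simp
    ring

theorem hasSum_gamv {v : ℕ → ℝ} (hv1 : ∀ n, 1 ≤ v n)
    (hvsum : ∀ n : ℕ, 1 ≤ n → ∑ j ∈ Finset.range n, v j ≤ v n) (m : ℕ) :
    HasSum (fun j => gamv v m (j + (m + 1))) (-betav v m) := by
  have hnn : ∀ j, 0 ≤ gamv v m (j + (m + 1)) := fun j =>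
    gamv_nonneg_of_lt hv1 (by omega)
  have hs : Summable fun j => gamv v m (j + (m + 1)) := by
    refine summable_of_sum_range_le (c := -betav v m) hnn fun n => ?_
    have h := sum_range_gamv hv1 m n
    have h1 := mul_nonpos_of_nonneg_of_nonpos (hnn n) (betav_neg hv1 (n + (m + 1))).le
    rw [Finset.sum_range_succ] at h
    linarith [hnn n]
  have h0 : Filter.Tendsto
      (fun p => gamv v m (p + (m + 1)) * betav v (p + (m + 1))) Filter.atTop (nhds 0) := by
    refine squeeze_zero_norm (fun p => ?_) hs.tendsto_atTop_zero
    have h1 := betav_neg hv1 (p + (m + 1))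
    have h2 := neg_one_le_betav hv1 hvsum (p + (m + 1))
    rw [norm_mul, Real.norm_of_nonneg (hnn p)]
    exact mul_le_of_le_one_right (hnn p) (abs_le.2 ⟨h2, by linarith⟩)
  refine (hs.hasSum_iff_tendsto_nat).2 ((Filter.tendsto_add_atTop_iff_nat 1).1 ?_)
  simp only [sum_range_gamv hv1]
  simpa using h0.const_add (-betav v m)

/-- If `ξ` is `1` above `m`, the diagonal relation at `m` says `ξ m ∈ {1, β m}`. -/
theorem eq_one_or_eq_betav {v : ℕ → ℝ} (hv1 : ∀ n, 1 ≤ v n)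
    (hvsum : ∀ n : ℕ, 1 ≤ n → ∑ j ∈ Finset.range n, v j ≤ v n) {ξ : ℕ → ℂ} {m : ℕ}
    (hdiag : HasSum (fun j : ℕ => (gamv v m j : ℂ) * ξ j) ((ξ m) ^ 2))
    (hone : ∀ k, m < k → ξ k = 1) : ξ m = 1 ∨ ξ m = (betav v m : ℂ) := by
  have h1 := (hasSum_nat_add_iff' (m + 1)).2 hdiag
  have h2 : HasSum (fun j => (gamv v m (j + (m + 1)) : ℂ) * ξ (j + (m + 1)))
      ((-betav v m : ℝ) : ℂ) := by
    have h := Complex.hasSum_ofReal.2 (hasSum_gamv hv1 hvsum m)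
    refine h.congr_fun fun j => ?_
    rw [hone _ (by omega), mul_one]
  have h3 : ∑ i ∈ Finset.range (m + 1), (gamv v m i : ℂ) * ξ i =
      ((1 + betav v m : ℝ) : ℂ) * ξ m := by
    rw [Finset.sum_range_succ, Finset.sum_eq_zero fun i hi => ?_, zero_add]
    · simp [gamv]
    · simp [gamv, Finset.mem_range.1 hi]
  have h4 := h1.unique h2
  rw [h3] at h4
  push_cast at h4
  have h5 : (ξ m - 1) * (ξ m - betav v m) = 0 := by linear_combination h4
  simpa [sub_eq_zero] using h5

/-- From the proof of Theorem 3.8: every continuous character `ξ : ℕ → ℂ` of the dual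
hypergroup (i.e. `ξ (min m n) = ξ m * ξ n` for `m ≠ n`, `ξ m² = ∑_j γ^m_j ξ j`, and
`ξ k → 1` as `k → ∞`) is either identically `1`, or there is `w` with `ξ = 0` below
`w`, `ξ w = β w` and `ξ = 1` above `w`. -/
theorem dual_character_classification (v : ℕ → ℝ) (hv0 : v 0 = 1) (hv1 : ∀ n, 1 ≤ v n)
    (hvsum : ∀ n : ℕ, 1 ≤ n → ∑ j ∈ Finset.range n, v j ≤ v n)
    (ξ : ℕ → ℂ)
    (hmul : ∀ m n : ℕ, m ≠ n → ξ (min m n) = ξ m * ξ n)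
    (hdiag : ∀ m : ℕ, HasSum (fun j : ℕ => (gamv v m j : ℂ) * ξ j) ((ξ m) ^ 2))
    (hcont : Filter.Tendsto ξ Filter.atTop (nhds 1)) :
    (∀ k : ℕ, ξ k = 1) ∨
    (∃ w : ℕ, (∀ k : ℕ, k < w → ξ k = 0) ∧ ξ w = (betav v w : ℂ) ∧
      ∀ k : ℕ, w < k → ξ k = 1) := by
  classical
  have hone : ∀ m, ξ m ≠ 0 → ∀ k, m < k → ξ k = 1 := fun m hm k hk => by
    have h := hmul m k hk.ne
    rw [min_eq_left hk.le] at h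
    exact mul_left_cancel₀ hm (by rw [← h, mul_one])
  have hex : ∃ m, ξ m ≠ 0 := (hcont.eventually_ne one_ne_zero).exists
  obtain ⟨w, hw, hmin⟩ : ∃ w, ξ w ≠ 0 ∧ ∀ k < w, ξ k = 0 :=
    ⟨Nat.find hex, Nat.find_spec hex, fun k hk => not_not.1 (Nat.find_min hex hk)⟩
  have habove := hone w hw
  rcases eq_one_or_eq_betav hv1 hvsum (hdiag w) habove with h1 | hβ
  · left
    rcases w with _ | m
    · intro k
      rcases k.eq_zero_or_pos with rfl | hk
      exacts [h1, habove k hk]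
    · have hm := hmin m m.lt_succ_self
      have habove' : ∀ k, m < k → ξ k = 1 := fun k hk => by
        rcases (Nat.succ_le_of_lt hk).eq_or_lt with rfl | h
        exacts [h1, habove k h]
      rcases eq_one_or_eq_betav hv1 hvsum (hdiag m) habove' with h | h
      · exact absurd (hm.symm.trans h) zero_ne_one
      · have hz : betav v m = 0 := by exact_mod_cast h.symm.trans hm
        exact absurd hz (betav_neg hv1 m).ne
  · exact Or.inr ⟨w, hmin, hβ, habove⟩
end

section
/- Suppose S is action-free, i.e., every invertible element g of S satisfying g·m = m for all m ∈ E_0(S) equals e. Then conv is associative (i.e., (S,*) is a commutative discrete semiconvo) if and only if all of the following hold: (i) E(S) is max-min type (m·n ∈ {m,n} for m,n ∈ E(S)) and, with the linear order m < n iff m·n = n ≠ m, E(S) is finite or order-isomorphic to (ℕ,≤); (ii) S̃ is an ideal of S: m·s ∈ S̃ for all m ∈ S̃ and s ∈ S; (iii) Q_n ⊆ E(S) for every n ∈ E_0(S); (iv) for every n ∈ E_0(S) and m ∈ S̃, j·m = n·m for all j ∈ Q_n; (v) 𝓛_n ⊆ Q_n ⊆ 𝓛_n ∪ {n} for every n ∈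 E_0(S), where 𝓛_n = {j ∈ E(S) : j < n}; (vi) if E(S) has more than 2 elements, then for all m,n ∈ E(S) with e ≠ m < n, q_n(e) = q_n(m)·q_m(e) and q_n(e)·(1 + ∑_{k ∈ 𝓛_n, k ≠ e} 1/q_k(e)) ≤ 1. -/
/-- `conv` is the deformation of the commutative monoid `S` along the probability measures `q n`
sitting on the idempotent diagonal. -/
structure IsDeformation {S : Type*} [CommMonoid S] [DecidableEq S] (q : S → S → ℝ)
    (conv : S → S → S → ℝ) : Prop where
  fin : ∀ n : S, n * n = n → n ≠ 1 → {j : S | q n j ≠ 0}.Finite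
  nonneg : ∀ n : S, n * n = n → n ≠ 1 → ∀ j, 0 ≤ q n j
  sum : ∀ n : S, n * n = n → n ≠ 1 → ∑ᶠ j, q n j = 1
  pos : ∀ n : S, n * n = n → n ≠ 1 → 0 < q n 1
  diag : ∀ n : S, n * n = n → n ≠ 1 → conv n n = q n
  off : ∀ m n : S, ¬(m = n ∧ n * n = n ∧ n ≠ 1) → ∀ j, conv m n j = if j = m * n then 1 else 0

theorem finsum_dirac_mul {S : Type*} [DecidableEq S] (a : S) (F : S → ℝ) :
    ∑ᶠ j, (if j = a then 1 else 0) * F j = F a := by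
  rw [finsum_eq_single _ a]
  · simp
  · intro x hx
    simp [hx]

namespace IsDeformation

variable {S : Type*} [CommMonoid S] [DecidableEq S] {q : S → S → ℝ} {conv : S → S → S → ℝ}

theorem conv_nonneg (h : IsDeformation q conv) (m n t : S) : 0 ≤ conv m n t := by
  by_cases hd : m = n ∧ n * n = n ∧ n ≠ 1
  · obtain ⟨rfl, h1, h2⟩ := hd
    rw [h.diag m h1 h2]
    exact h.nonneg m h1 h2 t
  · rw [h.off m n hd]
    split_ifs <;> norm_num

theorem conv_comm (h : IsDeformation q conv) (m n : S) : conv m n = conv n m := by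
  by_cases hmn : m = n
  · rw [hmn]
  · funext t
    rw [h.off m n (fun H => hmn H.1), h.off n m (fun H => hmn H.1.symm), mul_comm]

theorem support_finite (h : IsDeformation q conv) {n : S} (hn : n * n = n) (hn1 : n ≠ 1)
    (F : S → ℝ) : (Function.support fun j => q n j * F j).Finite := by
  refine (h.fin n hn hn1).subset fun j hj => ?_
  exact left_ne_zero_of_mul hj

theorem term_le_finsum (h : IsDeformation q conv) {n : S} (hn : n * n = n) (hn1 : n ≠ 1)
    (j k t : S) : q n j * conv j k t ≤ ∑ᶠ i, q n i * conv i k t :=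
  single_le_finsum j (h.support_finite hn hn1 fun i => conv i k t)
    fun i => mul_nonneg (h.nonneg n hn hn1 i) (h.conv_nonneg i k t)

theorem sum_eq_one (h : IsDeformation q conv) {n : S} (hn : n * n = n) (hn1 : n ≠ 1)
    {G : Finset S} (hG : ∀ j, q n j ≠ 0 → j ∈ G) : ∑ j ∈ G, q n j = 1 := by
  rw [← h.sum n hn hn1]
  exact (finsum_eq_sum_of_support_subset _ fun j hj => hG j hj).symm

/-- If convolving the support of `q n` with `k` always yields the point `k`, so does `q n`. -/
theorem finsum_eq_dirac (h : IsDeformation q conv) {n k : S} (hn : n * n = n) (hn1 : n ≠ 1)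
    (hk : ∀ j, q n j ≠ 0 → j * k = k ∧ ¬(j = k ∧ k * k = k ∧ k ≠ 1)) (t : S) :
    ∑ᶠ j, q n j * conv j k t = if t = k then 1 else 0 := by
  have key : ∀ j, q n j * conv j k t = q n j * if t = k then 1 else 0 := by
    intro j
    by_cases hj : q n j = 0
    · simp [hj]
    · rw [h.off j k (hk j hj).2, (hk j hj).1]
  rw [finsum_congr key, ← finsum_mul' _ _ (h.fin n hn hn1), h.sum n hn hn1, one_mul]

section Associative

variable (h : IsDeformation q conv)
  (hA : ∀ m n k t : S, ∑ᶠ j, conv m n j * conv j k t = ∑ᶠ j, conv n k j * conv m j t)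

include h hA

theorem finsum_eq_conv {n k : S} (hn : n * n = n) (hn1 : n ≠ 1) (hk : k ≠ n) (t : S) :
    ∑ᶠ j, q n j * conv j k t = conv n (n * k) t := by
  have := hA n n k t
  rw [h.diag n hn hn1] at this
  rw [this, finsum_congr (fun j => by rw [h.off n k (fun H => hk H.1.symm) j]),
    finsum_dirac_mul]

theorem mul_dichotomy {n k : S} (hn : n * n = n) (hn1 : n ≠ 1) (hk : k ≠ n) :
    (n * k = k ∧ ∀ j, q n j ≠ 0 → j * k = k ∧ ¬(j = k ∧ k * k = k ∧ k ≠ 1)) ∨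
    (n * k = n ∧ q n k ≠ 0 ∧ ∀ t, ∑ᶠ j, q n j * conv j k t = q n t) := by
  have hsum := h.finsum_eq_conv hA hn hn1 hk
  have h1k : conv 1 k k = 1 := by
    rw [h.off 1 k (by rintro ⟨rfl, -, h1⟩; exact h1 rfl)]
    simp
  have hpos : 0 < conv n (n * k) k := by
    have := h.term_le_finsum hn hn1 1 k k
    rw [hsum, h1k, mul_one] at this
    exact (h.pos n hn hn1).trans_le this
  by_cases hnk : n * k = n
  · right
    rw [hnk, h.diag n hn hn1] at hpos
    refine ⟨hnk, hpos.ne', fun t => ?_⟩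
    rw [hsum, hnk, h.diag n hn hn1]
  · left
    have hoff := h.off n (n * k) (fun H => hnk H.1.symm)
    have hmul : n * (n * k) = n * k := by rw [← mul_assoc, hn]
    have hk' : n * k = k := by
      by_contra hne
      rw [hoff, hmul, if_neg (fun H => hne H.symm)] at hpos
      exact lt_irrefl _ hpos
    refine ⟨hk', fun j hj => ?_⟩
    have hzero : ∀ t, t ≠ k → conv j k t = 0 := by
      intro t ht
      have := h.term_le_finsum hn hn1 j k t
      rw [hsum, hoff, hmul, hk', if_neg ht] at this
      have hqj : 0 < q n j := lt_of_le_of_ne (h.nonneg n hn hn1 j) (Ne.symm hj)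
      have := h.conv_nonneg j k t
      nlinarith
    have hnd : ¬(j = k ∧ k * k = k ∧ k ≠ 1) := by
      rintro ⟨rfl, h1, h2⟩
      have := hzero 1 (Ne.symm h2)
      rw [h.diag j h1 h2] at this
      exact (h.pos j h1 h2).ne' this
    refine ⟨?_, hnd⟩
    by_contra hne
    have := hzero _ hne
    rw [h.off j k hnd] at this
    simp at this

theorem mul_eq_or_of_idem {m : S} (hm : m * m = m) (n : S) :
    m * n = m ∨ m * n = n := by
  by_cases hm1 : m = 1
  · simp [hm1]
  by_cases hmn : n = m
  · left
    rw [hmn, hm]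
  rcases h.mul_dichotomy hA hm hm1 hmn with H | H
  · exact .inr H.1
  · exact .inl H.1

theorem eq_one_of_isUnit
    (hact : ∀ g : S, IsUnit g → (∀ m : S, m * m = m → m ≠ 1 → g * m = m) → g = 1)
    {g : S} (hg : IsUnit g) : g = 1 := by
  refine hact g hg fun n hn hn1 => ?_
  by_cases hgn : g = n
  · rw [hgn, hn]
  rcases h.mul_dichotomy hA hn hn1 hgn with H | H
  · exact absurd (hg.mul_right_cancel (by rw [H.1, one_mul] : n * g = 1 * g)) hn1
  · rw [mul_comm, H.1]

theorem mul_nonidem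
    (hact : ∀ g : S, IsUnit g → (∀ m : S, m * m = m → m ≠ 1 → g * m = m) → g = 1)
    {n m : S} (hn : n * n = n) (hn1 : n ≠ 1) (hm : m * m ≠ m) :
    n * m = m ∧ ∀ j, q n j ≠ 0 → j * m = m := by
  have hmn : m ≠ n := by
    rintro rfl
    exact hm hn
  rcases h.mul_dichotomy hA hn hn1 hmn with H | H
  · exact ⟨H.1, fun j hj => (H.2 j hj).1⟩
  · exfalso
    have hne : ∑ᶠ j, q n j * conv j m 1 ≠ 0 := by
      rw [H.2.2]
      exact (h.pos n hn hn1).ne'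
    obtain ⟨j, hj⟩ : ∃ j, q n j * conv j m 1 ≠ 0 := by
      by_contra! K
      exact hne (finsum_eq_zero_of_forall_eq_zero K)
    have hj' := right_ne_zero_of_mul hj
    rw [h.off j m (fun K => hm K.2.1)] at hj'
    have hjm : 1 = j * m := by
      by_contra hc
      simp [hc] at hj'
    have := h.eq_one_of_isUnit hA hact (g := m) (IsUnit.of_mul_eq_one j (by rw [mul_comm, ← hjm]))
    exact hm (by simp [this])

theorem support_idem
    (hact : ∀ g : S, IsUnit g → (∀ m : S, m * m = m → m ≠ 1 → g * m = m) → g = 1)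
    {n j : S} (hn : n * n = n) (hn1 : n ≠ 1) (hj : q n j ≠ 0) : j * j = j := by
  by_contra hjj
  exact hjj ((h.mul_nonidem hA hact hn hn1 hjj).2 j hj)

theorem nonidem_mul
    (hact : ∀ g : S, IsUnit g → (∀ m : S, m * m = m → m ≠ 1 → g * m = m) → g = 1)
    {m : S} (hm : m * m ≠ m) (s : S) : (m * s) * (m * s) ≠ m * s := by
  intro hf
  by_cases hs : s * s = s
  · by_cases hs1 : s = 1
    · simp only [hs1, mul_one] at hf
      exact hm hf
    · rw [mul_comm m s, (h.mul_nonidem hA hact hs hs1 hm).1] at hf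
      exact hm hf
  by_cases hf1 : m * s = 1
  · exact hm (by simp [h.eq_one_of_isUnit hA hact (IsUnit.of_mul_eq_one s hf1)])
  have hfs : s * (m * s) = s := by
    rw [mul_comm]
    exact (h.mul_nonidem hA hact hf hf1 hs).1
  have key := hA m s (m * s) 1
  rw [finsum_congr (fun j => by rw [h.off m s (fun K => hs K.2.1) j]), finsum_dirac_mul,
    h.diag _ hf hf1,
    finsum_congr (fun j => by rw [h.off s (m * s) (fun K => hs (K.1 ▸ K.2.1)) j]),
    finsum_dirac_mul, hfs, h.off m s (fun K => hs K.2.1), if_neg (Ne.symm hf1)] at key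
  exact (h.pos _ hf hf1).ne' key

theorem mem_support_of_lt {n j : S} (hn : n * n = n) (hn1 : n ≠ 1) (hjn : j * n = n)
    (hne : j ≠ n) : q n j ≠ 0 := by
  rcases h.mul_dichotomy hA hn hn1 hne with H | H
  · rw [mul_comm, hjn] at H
    exact absurd H.1.symm hne
  · exact H.2.1

theorem le_of_mem_support
    (hact : ∀ g : S, IsUnit g → (∀ m : S, m * m = m → m ≠ 1 → g * m = m) → g = 1)
    {n j : S} (hn : n * n = n) (hn1 : n ≠ 1) (hj : q n j ≠ 0) : j * n = n := by
  by_cases hjn : j = n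
  · rw [hjn, hn]
  rw [mul_comm]
  rcases h.mul_dichotomy hA hn hn1 hjn with H | H
  · by_cases hj1 : j = 1
    · simp [hj1]
    · exact absurd ⟨rfl, h.support_idem hA hact hn hn1 hj, hj1⟩ (H.2 j hj).2
  · exact H.1

theorem apply_one_eq_mul
    (hact : ∀ g : S, IsUnit g → (∀ m : S, m * m = m → m ≠ 1 → g * m = m) → g = 1)
    {m n : S} (hm : m * m = m) (hn : n * n = n) (hm1 : m ≠ 1) (hmn : m * n = n) (hne : m ≠ n) :
    q n 1 = q n m * q m 1 := by
  have hn1 : n ≠ 1 := by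
    rintro rfl
    exact hm1 (by simpa using hmn)
  rcases h.mul_dichotomy hA hn hn1 hne with H | H
  · rw [mul_comm, hmn] at H
    exact absurd H.1.symm hne
  rw [← H.2.2 1, finsum_eq_single _ m, h.diag m hm hm1]
  intro j hj
  by_cases hqj : q n j = 0
  · simp [hqj]
  rw [h.off j m (fun K => hj K.1), if_neg, mul_zero]
  intro hjm
  rcases h.mul_eq_or_of_idem hA (h.support_idem hA hact hn hn1 hqj) m with K | K
  · rw [← hjm] at K
    rw [← K, one_mul] at hjm
    exact hm1 hjm.symm
  · exact hm1 (by rw [← K, ← hjm])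

theorem lower_finite {n : S} (hn : n * n = n) (hn1 : n ≠ 1) :
    {k : S | k * n = n ∧ k ≠ n}.Finite :=
  (h.fin n hn hn1).subset fun _ hk => h.mem_support_of_lt hA hn hn1 hk.1 hk.2

theorem apply_one_mul_le
    (hact : ∀ g : S, IsUnit g → (∀ m : S, m * m = m → m ≠ 1 → g * m = m) → g = 1)
    {n : S} (hn : n * n = n) (hn1 : n ≠ 1) :
    q n 1 * (1 + ∑ᶠ k ∈ {k : S | k * k = k ∧ k ≠ 1 ∧ k * n = n ∧ k ≠ n}, 1 / q k 1) ≤ 1 := by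
  set A := {k : S | k * k = k ∧ k ≠ 1 ∧ k * n = n ∧ k ≠ n} with hAdef
  have hAfin : A.Finite := (h.lower_finite hA hn hn1).subset fun k hk => hk.2.2
  rw [finsum_mem_eq_finite_toFinset_sum _ hAfin, mul_add, mul_one, Finset.mul_sum]
  have hterm : ∀ k ∈ hAfin.toFinset, q n 1 * (1 / q k 1) = q n k := by
    intro k hk
    obtain ⟨h1, h2, h3, h4⟩ := hAfin.mem_toFinset.1 hk
    rw [h.apply_one_eq_mul hA hact h1 hn h2 h3 h4]
    have := (h.pos k h1 h2).ne'
    field_simp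
  rw [Finset.sum_congr rfl hterm, ← Finset.sum_insert (f := fun k => q n k)
    (fun H => (hAfin.mem_toFinset.1 H).2.1 rfl),
    ← h.sum_eq_one hn hn1 (G := (h.fin n hn hn1).toFinset) (fun j hj => by simpa using hj)]
  refine Finset.sum_le_sum_of_subset_of_nonneg (fun k hk => ?_)
    fun k _ _ => h.nonneg n hn hn1 k
  rw [Set.Finite.mem_toFinset]
  rcases Finset.mem_insert.1 hk with rfl | hk
  · exact (h.pos n hn hn1).ne'
  · have hk := hAfin.mem_toFinset.1 hk
    exact h.mem_support_of_lt hA hn hn1 hk.2.2.1 hk.2.2.2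

end Associative

end IsDeformation

/-- An infinite max-min semilattice of idempotents with finite lower sets is ordered like `ℕ`. -/
theorem exists_bijective_nat_of_infinite {S : Type*} [CommMonoid S]
    (hmm : ∀ m n : S, m * m = m → n * n = n → (m * n = m ∨ m * n = n))
    (hlow : ∀ n : S, n * n = n → {k : S | k * n = n ∧ k ≠ n}.Finite)
    (hinf : ¬{x : S | x * x = x}.Finite) :
    ∃ f : {x : S // x * x = x} → ℕ, Function.Bijective f ∧
      ∀ a b : {x : S // x * x = x}, ((a : S) * b = b ↔ f a ≤ f b) := by
  let E := {x : S // x * x = x}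
  have : Infinite E := Set.infinite_coe_iff.2 hinf
  let L : E → Set E := fun n => {k | (k : S) * n = n ∧ k ≠ n}
  have hL : ∀ n, (L n).Finite := fun n =>
    ((hlow n n.2).preimage Subtype.val_injective.injOn).subset
      fun k hk => ⟨hk.1, fun H => hk.2 (Subtype.ext H)⟩
  have trans : ∀ a b c : E, (a : S) * b = b → (b : S) * c = c → (a : S) * c = c := by
    intro a b c hab hbc
    rw [← hbc, ← mul_assoc, hab]
  have antisymm : ∀ a b : E, (a : S) * b = b → (b : S) * a = a → a = b := by
    intro a b hab hba
    exact Subtype.ext (by rw [← hba, mul_comm, hab])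
  let f : E → ℕ := fun n => (L n).ncard
  have hlt : ∀ a b : E, (a : S) * b = b → a ≠ b → f a < f b := by
    intro a b hab hne
    refine Set.ncard_lt_ncard ?_ (hL b)
    refine ⟨fun k hk => ⟨trans k a b hk.1 hab, ?_⟩, fun H => (H (a := a) ⟨hab, hne⟩).2 rfl⟩
    rintro rfl
    exact hk.2 (antisymm _ _ hk.1 hab)
  have hle : ∀ a b : E, ((a : S) * b = b ↔ f a ≤ f b) := by
    intro a b
    constructor
    · intro hab
      by_cases hne : a = b
      · rw [hne]
      · exact (hlt a b hab hne).le
    · intro hf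
      by_contra hab
      have hba : (b : S) * a = a := by
        rw [mul_comm]
        exact (hmm a b a.2 b.2).resolve_right hab
      have hne : b ≠ a := by
        rintro rfl
        exact hab b.2
      exact absurd (hlt b a hba hne) (not_lt.2 hf)
  refine ⟨f, ⟨fun a b hab => antisymm a b ((hle a b).2 hab.le) ((hle b a).2 hab.ge), ?_⟩, hle⟩
  intro c
  induction c with
  | zero =>
    refine ⟨⟨1, one_mul 1⟩, ?_⟩
    have : L ⟨1, one_mul 1⟩ = ∅ := by
      ext k
      simp only [L, mul_one, Set.mem_ofPred_eq, Set.mem_empty_iff_false, iff_false, not_and, not_not]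
      exact fun hk => Subtype.ext hk
    simp [f, this]
  | succ c ih =>
    obtain ⟨a, ha⟩ := ih
    have hex : ∃ d, ∃ b, f b = d ∧ f a < d := by
      obtain ⟨b, hb⟩ := ((hL a).insert a).infinite_compl.nonempty
      refine ⟨f b, b, rfl, ?_⟩
      by_contra hba
      have h1 := (hle b a).2 (not_lt.1 hba)
      apply hb
      by_cases hne : b = a
      · exact .inl hne
      · exact .inr ⟨h1, hne⟩
    classical
    obtain ⟨b, hb, hab⟩ := Nat.find_spec hex
    rw [← hb] at hab
    refine ⟨b, ?_⟩
    have hLb : L b = insert a (L a) := by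
      ext k
      constructor
      · intro hk
        have hkb := hlt k b hk.1 hk.2
        rw [hb] at hkb
        have hka : f k ≤ f a := not_lt.1 fun H => Nat.find_min hex hkb ⟨k, rfl, H⟩
        by_cases hne : k = a
        · exact .inl hne
        · exact .inr ⟨(hle k a).2 hka, hne⟩
      · have hne : a ≠ b := by
          rintro rfl
          exact lt_irrefl _ hab
        have hab' := (hle a b).2 hab.le
        rintro (rfl | hk)
        · exact ⟨hab', hne⟩
        · refine ⟨trans k a b hk.1 hab', ?_⟩
          rintro rfl
          exact hne (antisymm _ _ hab' hk.1)
    calc f b = (insert a (L a)).ncard := by rw [← hLb]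
      _ = (L a).ncard + 1 := Set.ncard_insert_of_notMem (fun H => H.2 rfl) (hL a)
      _ = c + 1 := by rw [← ha]

namespace IsDeformation

variable {S : Type*} [CommMonoid S] [DecidableEq S] {q : S → S → ℝ} {conv : S → S → S → ℝ}

section Converse

variable (h : IsDeformation q conv)
  (hmm : ∀ m n : S, m * m = m → n * n = n → (m * n = m ∨ m * n = n))
  (hQ : ∀ n : S, n * n = n → n ≠ 1 → ∀ j : S, q n j ≠ 0 → j * j = j ∧ j * n = n)
  (hmul : ∀ m n : S, m * m = m → n * n = n → m ≠ 1 → m * n = n → m ≠ n →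
    q n 1 = q n m * q m 1)

include h hmm hQ hmul

theorem finsum_eq_of_ne {m k : S} (hm : m * m = m) (hm1 : m ≠ 1) (hk : k * k = k) (hk1 : k ≠ 1)
    (hkm : k * m = m) (hne : k ≠ m) {t : S} (htk : t ≠ k) :
    ∑ᶠ j, q m j * conv j k t = q m t := by
  by_cases ht : t * t = t ∧ t * k = t
  · rw [finsum_eq_single _ t, h.off t k (fun K => htk K.1), ht.2, if_pos rfl, mul_one]
    intro j hj
    by_cases hqj : q m j = 0
    · simp [hqj]
    refine mul_eq_zero_of_right _ ?_
    by_cases hjk : j = k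
    · rw [hjk, h.diag k hk hk1]
      by_contra hqk
      have := (hQ k hk hk1 t hqk).2
      rw [ht.2] at this
      exact htk this
    · rw [h.off j k (fun K => hjk K.1), if_neg]
      rintro rfl
      rcases hmm j k (hQ m hm hm1 j hqj).1 hk with K | K
      · exact hj K.symm
      · exact htk K
  · rw [finsum_eq_single _ k, h.diag k hk hk1]
    · by_cases htt : t * t = t
      · have htk' : t * k = k := (hmm t k htt hk).resolve_left fun K => ht ⟨htt, K⟩
        by_cases ht1 : t = 1
        · rw [ht1, hmul k m hk hm hk1 hkm hne]
        · have htm : t * m = m := by rw [← hkm, ← mul_assoc, htk']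
          have htm' : t ≠ m := by
            rintro rfl
            rw [mul_comm, hkm] at htk'
            exact htk htk'
          have e1 := hmul k m hk hm hk1 hkm hne
          have e2 := hmul t m htt hm ht1 htm htm'
          have e3 := hmul t k htt hk ht1 htk' htk
          have hp := (h.pos t htt ht1).ne'
          apply mul_right_cancel₀ hp
          rw [← e2, e1, e3, mul_assoc]
      · have h1 : q k t = 0 := by
          by_contra K
          exact htt (hQ k hk hk1 t K).1
        have h2 : q m t = 0 := by
          by_contra K
          exact htt (hQ m hm hm1 t K).1
        rw [h1, h2, mul_zero]
    · intro j hj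
      by_cases hqj : q m j = 0
      · simp [hqj]
      rw [h.off j k (fun K => hj K.1), if_neg, mul_zero]
      rintro rfl
      have hjj := (hQ m hm hm1 j hqj).1
      rcases hmm j k hjj hk with K | K
      · rw [K] at ht
        exact ht ⟨hjj, K⟩
      · exact htk K

theorem finsum_eq_self {m k : S} (hm : m * m = m) (hm1 : m ≠ 1) (hk : k * k = k) (hk1 : k ≠ 1)
    (hkm : k * m = m) (hne : k ≠ m) (t : S) : ∑ᶠ j, q m j * conv j k t = q m t := by
  by_cases htk : t ≠ k
  · exact h.finsum_eq_of_ne hmm hQ hmul hm hm1 hk hk1 hkm hne htk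
  rw [not_not.1 htk]
  let F := (h.fin m hm hm1).toFinset
  let G := insert k (F ∪ (h.fin k hk hk1).toFinset)
  have hsum : ∀ t, ∑ᶠ j, q m j * conv j k t = ∑ j ∈ F, q m j * conv j k t := fun t =>
    finsum_eq_sum_of_support_subset _ fun j hj => by
      simpa [F] using left_ne_zero_of_mul hj
  have hmass : ∀ j ∈ F, ∑ t ∈ G, conv j k t = 1 := by
    intro j hj
    by_cases hjk : j = k
    · rw [hjk, h.diag k hk hk1]
      exact h.sum_eq_one hk hk1 fun i hi => by simp [G, hi]
    · have hjk' : j * k ∈ G := by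
        have hqj : q m j ≠ 0 := by simpa [F] using hj
        rcases hmm j k (hQ m hm hm1 j hqj).1 hk with K | K
        · rw [K]
          simp [G, hj]
        · rw [K]
          simp [G]
      rw [Finset.sum_congr rfl fun t _ => h.off j k (fun K => hjk K.1) t]
      simp [hjk']
  have htotal : ∑ t ∈ G, (∑ᶠ j, q m j * conv j k t - q m t) = 0 := by
    rw [Finset.sum_sub_distrib, h.sum_eq_one hm hm1 fun i hi => by simp [G, F, hi],
      Finset.sum_congr rfl fun t _ => hsum t, Finset.sum_comm]
    simp_rw [← Finset.mul_sum]
    rw [Finset.sum_congr rfl fun j hj => by rw [hmass j hj, mul_one],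
      h.sum_eq_one hm hm1 fun i hi => by simp [F, hi], sub_self]
  rw [Finset.sum_eq_single_of_mem k (by simp [G]) fun t _ ht =>
    sub_eq_zero.2 (h.finsum_eq_of_ne hmm hQ hmul hm hm1 hk hk1 hkm hne ht)] at htotal
  exact sub_eq_zero.1 htotal

theorem finsum_eq_conv_of_ne
    (habs : ∀ n m : S, n * n = n → n ≠ 1 → ¬(m * m = m) → ∀ j, q n j ≠ 0 → j * m = n * m)
    {n k : S} (hn : n * n = n) (hn1 : n ≠ 1) (hkn : k ≠ n) (t : S) :
    ∑ᶠ j, q n j * conv j k t = conv n (n * k) t := by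
  have hdirac (hnk : n * k = k)
      (H : ∀ j, q n j ≠ 0 → j * k = k ∧ ¬(j = k ∧ k * k = k ∧ k ≠ 1)) :
      ∑ᶠ j, q n j * conv j k t = conv n (n * k) t := by
    rw [h.finsum_eq_dirac hn hn1 H, hnk, h.off n k (fun K => hkn K.1.symm), hnk]
  by_cases hk : k * k = k
  · by_cases hnk : n * k = n
    · rw [hnk, h.diag n hn hn1]
      by_cases hk1 : k = 1
      · have : ∀ j, q n j * conv j k t = (if j = t then 1 else 0) * q n j := by
          intro j
          rw [hk1, h.off j 1 (fun K => K.2.2 rfl), mul_one, mul_comm]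
          simp only [eq_comm]
        rw [finsum_congr this, finsum_dirac_mul]
      · exact h.finsum_eq_self hmm hQ hmul hn hn1 hk hk1 (by rw [mul_comm, hnk]) hkn t
    · have hnk' := (hmm n k hn hk).resolve_left hnk
      refine hdirac hnk' fun j hj => ⟨?_, ?_⟩
      · rw [← hnk', ← mul_assoc, (hQ n hn hn1 j hj).2]
      · rintro ⟨rfl, -, -⟩
        exact hnk (by rw [mul_comm, (hQ n hn hn1 j hj).2])
  · have hnk : n * k = k := by
      rw [← habs n k hn hn1 hk 1 (h.pos n hn hn1).ne', one_mul]
    exact hdirac hnk fun j hj => ⟨by rw [habs n k hn hn1 hk j hj, hnk], fun K => hk K.2.1⟩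

theorem associative_of_conditions
    (hideal : ∀ m s : S, ¬(m * m = m) → ¬((m * s) * (m * s) = m * s))
    (habs : ∀ n m : S, n * n = n → n ≠ 1 → ¬(m * m = m) → ∀ j, q n j ≠ 0 → j * m = n * m)
    (m n k t : S) :
    ∑ᶠ j, conv m n j * conv j k t = ∑ᶠ j, conv n k j * conv m j t := by
  have hD := fun {n k : S} => h.finsum_eq_conv_of_ne hmm hQ hmul habs (n := n) (k := k)
  simp_rw [h.conv_comm m]
  rw [h.conv_comm n m]
  have hoff : ∀ a b c : S, ¬(a = b ∧ b * b = b ∧ b ≠ 1) →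
      ∑ᶠ j, conv a b j * conv j c t = conv (a * b) c t := by
    intro a b c hab
    rw [finsum_congr (fun j => by rw [h.off a b hab j]), finsum_dirac_mul]
  by_cases hmn : m = n ∧ n * n = n ∧ n ≠ 1
  · obtain ⟨rfl, hm, hm1⟩ := hmn
    by_cases hkm : k = m
    · rw [hkm]
    · rw [h.diag m hm hm1, hD hm hm1 hkm, hoff m k m (fun K => hkm K.1.symm), h.conv_comm]
  by_cases hnk : n = k ∧ k * k = k ∧ k ≠ 1
  · obtain ⟨rfl, hn, hn1⟩ := hnk
    have hmn' : m ≠ n := fun K => hmn ⟨K, hn, hn1⟩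
    rw [h.diag n hn hn1, hD hn hn1 hmn', hoff m n n hmn, h.conv_comm, mul_comm]
  rw [hoff m n k hmn, hoff n k m hnk]
  by_cases hkm : k = m
  · rw [hkm, mul_comm]
  have idem_left : ∀ a b : S, (a * b) * (a * b) = a * b → a * a = a := fun a b hab =>
    not_not.1 fun K => hideal a b K hab
  have nondiag : ∀ a b c : S, ¬(a = b ∧ b * b = b ∧ b ≠ 1) → c ≠ a → ¬(b = c ∧ c * c = c ∧ c ≠ 1) →
      ¬(a * b = c ∧ c * c = c ∧ c ≠ 1) := by
    rintro a b c - hca hbc ⟨rfl, hc, hc1⟩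
    rcases hmm a b (idem_left a b hc) (idem_left b a (by rw [mul_comm b a, hc])) with K | K
    · exact hca K
    · exact hbc ⟨K.symm, hc, hc1⟩
  rw [h.off _ _ (nondiag m n k hmn hkm hnk), h.off (n * k) m, mul_comm (n * k) m, mul_assoc]
  rw [mul_comm n k]
  refine nondiag k n m (fun K => hnk ⟨K.1.symm, ?_⟩) (Ne.symm hkm) (fun K => hmn ⟨K.1.symm, ?_⟩)
  · rw [K.1]
    exact K.2
  · rw [K.1]
    exact K.2

end Converse

end IsDeformation


/-- Theorem 4.3 (main theorem, semiconvo characterization): Let `(S, ·)` be an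
action-free commutative monoid with nonempty `E₀(S)`, with deformed convolution `conv`
given by probability measures `q n` on the idempotent diagonal. Then `conv` is
associative (i.e. `(S, conv)` is a commutative discrete semiconvo) if and only if:
(i) `E(S)` is max-min type and, under the order `m < n ↔ m·n = n ≠ m`, `E(S)` is
finite or order-isomorphic to `(ℕ, ≤)`;
(ii) `S̃ = S \ E(S)` is an ideal of `S`;
(iii) `Qₙ ⊆ E(S)` for all `n ∈ E₀(S)`;
(iv) for `n ∈ E₀(S)` and `m ∈ S̃`, `Qₙ · m = {n·m}`;
(v) `𝓛ₙ ⊆ Qₙ ⊆ 𝓛ₙ ∪ {n}` for all `n ∈ E₀(S)`;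
(vi) if `E(S)` has more than two elements, then for `1 ≠ m < n` in `E(S)`,
`q n 1 = q n m · q m 1` and `q n 1 · (1 + ∑_{1 ≠ k ∈ 𝓛ₙ} 1 / q k 1) ≤ 1`. -/
theorem semiconvo_deformation_main {S : Type*} [CommMonoid S] [DecidableEq S]
    (hE0 : ∃ n : S, n * n = n ∧ n ≠ 1)
    (hact : ∀ g : S, IsUnit g → (∀ m : S, m * m = m → m ≠ 1 → g * m = m) → g = 1)
    (q : S → S → ℝ)
    (hq_fin : ∀ n : S, n * n = n → n ≠ 1 → {j : S | q n j ≠ 0}.Finite)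
    (hq_nonneg : ∀ n : S, n * n = n → n ≠ 1 → ∀ j, 0 ≤ q n j)
    (hq_sum : ∀ n : S, n * n = n → n ≠ 1 → ∑ᶠ j, q n j = 1)
    (hq_e : ∀ n : S, n * n = n → n ≠ 1 → 0 < q n 1)
    (conv : S → S → S → ℝ)
    (hconv_diag : ∀ n : S, n * n = n → n ≠ 1 → conv n n = q n)
    (hconv_off : ∀ m n : S, ¬(m = n ∧ n * n = n ∧ n ≠ 1) →
      ∀ j, conv m n j = if j = m * n then 1 else 0) :
    (∀ m n k t : S,
      ∑ᶠ j, conv m n j * conv j k t = ∑ᶠ j, conv n k j * conv m j t) ↔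
    ((∀ m n : S, m * m = m → n * n = n → (m * n = m ∨ m * n = n)) ∧
      ({x : S | x * x = x}.Finite ∨
        ∃ f : {x : S // x * x = x} → ℕ, Function.Bijective f ∧
          ∀ a b : {x : S // x * x = x}, ((a : S) * b = b ↔ f a ≤ f b))) ∧
    (∀ m s : S, ¬(m * m = m) → ¬((m * s) * (m * s) = m * s)) ∧
    (∀ n : S, n * n = n → n ≠ 1 → ∀ j, q n j ≠ 0 → j * j = j) ∧
    (∀ n m : S, n * n = n → n ≠ 1 → ¬(m * m = m) →
      ∀ j, q n j ≠ 0 → j * m = n * m) ∧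
    (∀ n : S, n * n = n → n ≠ 1 →
      (∀ j : S, j * j = j → j * n = n → j ≠ n → q n j ≠ 0) ∧
      (∀ j : S, q n j ≠ 0 → j * j = j ∧ j * n = n)) ∧
    ((∃ a b c : S, a * a = a ∧ b * b = b ∧ c * c = c ∧ a ≠ b ∧ b ≠ c ∧ a ≠ c) →
      ∀ m n : S, m * m = m → n * n = n → m ≠ 1 → m * n = n → m ≠ n →
        q n 1 = q n m * q m 1 ∧
        q n 1 * (1 + ∑ᶠ k ∈ {k : S | k * k = k ∧ k ≠ 1 ∧ k * n = n ∧ k ≠ n},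
          1 / q k 1) ≤ 1) := by
  have h : IsDeformation q conv := ⟨hq_fin, hq_nonneg, hq_sum, hq_e, hconv_diag, hconv_off⟩
  constructor
  · intro hA
    have hmm : ∀ m n : S, m * m = m → n * n = n → (m * n = m ∨ m * n = n) :=
      fun m n hm _ => h.mul_eq_or_of_idem hA hm n
    refine ⟨⟨hmm, or_iff_not_imp_left.2 (exists_bijective_nat_of_infinite hmm ?_)⟩, ?_, ?_, ?_,
      ?_, ?_⟩
    · intro n hn
      by_cases hn1 : n = 1
      · simp [hn1]
      · exact h.lower_finite hA hn hn1
    · exact fun m s hm => h.nonidem_mul hA hact hm s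
    · exact fun n hn hn1 j hj => h.support_idem hA hact hn hn1 hj
    · intro n m hn hn1 hm j hj
      obtain ⟨h1, h2⟩ := h.mul_nonidem hA hact hn hn1 hm
      rw [h1, h2 j hj]
    · exact fun n hn hn1 => ⟨fun j _ hjn hne => h.mem_support_of_lt hA hn hn1 hjn hne,
        fun j hj => ⟨h.support_idem hA hact hn hn1 hj, h.le_of_mem_support hA hact hn hn1 hj⟩⟩
    · intro _ m n hm hn hm1 hmn hne
      refine ⟨h.apply_one_eq_mul hA hact hm hn hm1 hmn hne, h.apply_one_mul_le hA hact hn ?_⟩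
      rintro rfl
      exact hm1 (by simpa using hmn)
  · rintro ⟨⟨hmm, -⟩, hideal, -, hiv, hv, hvi⟩
    refine h.associative_of_conditions hmm (fun n hn hn1 => (hv n hn hn1).2) ?_ hideal hiv
    intro m n hm hn hm1 hmn hne
    refine (hvi ⟨1, m, n, one_mul 1, hm, hn, hm1.symm, hne, ?_⟩ m n hm hn hm1 hmn hne).1
    rintro rfl
    exact hm1 (by simpa using hmn)
end
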